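/- Let G1 ⊏ G2 ⊏ … be a strictly ascending (finite or infinite) sequence of finite E-graphs (G_i ⊑ G_{i+1} and G_i not isomorphic to G_{i+1}). If the least upper bound ⊔_i G_i is a finite E-graph, then the sequence is finite. -/

import Mathlib

set_option autoImplicit false

/-! ## Terms over a signature -/

inductive Tm (F : Type) (ar : F → ℕ) (V : Type) : Type where
  | var : V → Tm F ar V
  | node : (f : F) → (Fin (ar f) → Tm F ar V) → Tm F ar V

namespace Tm

variable {F : Type} {ar : F → ℕ} {V W : Type}

/-- Apply a renaming of variables/states. -/
def map (σ : V → W) : Tm F ar V → Tm F ar W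
  | .var v => .var (σ v)
  | .node f ts => .node f fun i => (ts i).map σ

/-- Apply a substitution. -/
def subst (σ : V → Tm F ar W) : Tm F ar V → Tm F ar W
  | .var v => σ v
  | .node f ts => .node f fun i => (ts i).subst σ

/-- The set of variables occurring in a pattern. -/
def vars : Tm F ar V → Set V
  | .var v => {v}
  | .node _ ts => ⋃ i, (ts i).vars

end Tm

/-- Ground terms: terms with no variables. -/
abbrev GTm (F : Type) (ar : F → ℕ) : Type := Tm F ar Empty

/-- A ground term viewed as a term over `Σ ∪ V`. -/
def GTm.embed {F : Type} {ar : F → ℕ} {V : Type} (t : GTm F ar) : Tm F ar V :=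
  Tm.map (fun e => e.elim) t

/-- The (reflexive) subterm relation. -/
inductive Subterm {F : Type} {ar : F → ℕ} {V : Type} : Tm F ar V → Tm F ar V → Prop where
  | refl (t : Tm F ar V) : Subterm t t
  | node {u : Tm F ar V} {f : F} {ts : Fin (ar f) → Tm F ar V} (i : Fin (ar f)) :
      Subterm u (ts i) → Subterm u (.node f ts)

theorem Subterm.trans' {F : Type} {ar : F → ℕ} {V : Type} {a b c : Tm F ar V}
    (h1 : Subterm a b) (h2 : Subterm b c) : Subterm a c := by
  induction h2 with
  | refl => exact h1
  | node i _ ih => exact Subterm.node i ih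

theorem Subterm.child {F : Type} {ar : F → ℕ} {V : Type} {f : F}
    {ts : Fin (ar f) → Tm F ar V} {c : Tm F ar V} (i : Fin (ar f))
    (h : Subterm (.node f ts) c) : Subterm (ts i) c :=
  Subterm.trans' (Subterm.node i (Subterm.refl _)) h

/-! ## Tree automata and E-graphs -/

/-- A (bottom-up, possibly infinite) tree automaton: a set of states together with
transitions `f(q₁,…,qₖ) → q`. -/
structure Automaton (F : Type) (ar : F → ℕ) : Type 1 where
  Q : Type
  trans : (f : F) → Set ((Fin (ar f) → Q) × Q)

/-- `Accepts A t q` formalizes `t →*_A q`: the term `t ∈ T(Σ ∪ Q)` rewrites to the state `q`. -/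
inductive Accepts {F : Type} {ar : F → ℕ} (A : Automaton F ar) : Tm F ar A.Q → A.Q → Prop where
  | var (q : A.Q) : Accepts A (.var q) q
  | node {f : F} {ts : Fin (ar f) → Tm F ar A.Q} {qs : Fin (ar f) → A.Q} {q : A.Q} :
      (∀ i, Accepts A (ts i) (qs i)) → (qs, q) ∈ A.trans f → Accepts A (.node f ts) q

/-- A ground term `t ∈ T(Σ)` is accepted by the state `q`, i.e. `t →*_A q`. -/
def Automaton.AcceptsG {F : Type} {ar : F → ℕ} (A : Automaton F ar) (t : GTm F ar) (q : A.Q) : Prop :=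
  Accepts A (GTm.embed t) q

/-- Deterministic: every ground term is accepted by at most one state. -/
def Automaton.Deterministic {F : Type} {ar : F → ℕ} (A : Automaton F ar) : Prop :=
  ∀ (t : GTm F ar) (q1 q2 : A.Q), A.AcceptsG t q1 → A.AcceptsG t q2 → q1 = q2

/-- Reachable: every state accepts some ground term. -/
def Automaton.ReachableA {F : Type} {ar : F → ℕ} (A : Automaton F ar) : Prop :=
  ∀ q : A.Q, ∃ t : GTm F ar, A.AcceptsG t q

/-- An E-graph is a deterministic and reachable tree automaton. -/
structure EGraph (F : Type) (ar : F → ℕ) extends Automaton F ar where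
  det : toAutomaton.Deterministic
  reach : toAutomaton.ReachableA

/-- A homomorphism of tree automata: maps states to states, preserving all transitions. -/
structure AHom {F : Type} {ar : F → ℕ} (A B : Automaton F ar) : Type where
  toFun : A.Q → B.Q
  map_trans : ∀ (f : F) (qs : Fin (ar f) → A.Q) (q : A.Q),
    (qs, q) ∈ A.trans f → (fun i => toFun (qs i), toFun q) ∈ B.trans f

/-- `A ⊑ B` : there exists a homomorphism from `A` to `B`. -/
def ALe {F : Type} {ar : F → ℕ} (A B : Automaton F ar) : Prop := Nonempty (AHom A B)

def EGraph.Le {F : Type} {ar : F → ℕ} (G H : EGraph F ar) : Prop :=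
  ALe G.toAutomaton H.toAutomaton

/-- Isomorphism of E-graphs: mutually inverse homomorphisms. -/
def EGraph.Iso {F : Type} {ar : F → ℕ} (G H : EGraph F ar) : Prop :=
  ∃ (h : AHom G.toAutomaton H.toAutomaton) (h' : AHom H.toAutomaton G.toAutomaton),
    (∀ q, h'.toFun (h.toFun q) = q) ∧ (∀ q, h.toFun (h'.toFun q) = q)

/-- The partial congruence relation `≈_G` induced by an E-graph:
two ground terms are related iff some state accepts both. -/
def EGraph.eqv {F : Type} {ar : F → ℕ} (G : EGraph F ar) (t1 t2 : GTm F ar) : Prop :=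
  ∃ q : G.Q, G.toAutomaton.AcceptsG t1 q ∧ G.toAutomaton.AcceptsG t2 q

/-- A finite E-graph: finitely many states and transitions. -/
def EGraph.IsFinite {F : Type} {ar : F → ℕ} (G : EGraph F ar) : Prop :=
  Finite G.Q ∧ ∀ f : F, (G.trans f).Finite

/-! ## Partial congruence relations -/

/-- A partial congruence relation (PCR) on ground terms: a symmetric, transitive,
congruent and reachable binary relation. -/
structure IsPCR {F : Type} {ar : F → ℕ} (E : GTm F ar → GTm F ar → Prop) : Prop where
  symm : ∀ {t1 t2 : GTm F ar}, E t1 t2 → E t2 t1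
  trans : ∀ {t1 t2 t3 : GTm F ar}, E t1 t2 → E t2 t3 → E t1 t3
  congruent : ∀ (f : F) (s t : Fin (ar f) → GTm F ar),
    (∀ i, E (s i) (t i)) → E (.node f s) (.node f s) → E (.node f s) (.node f t)
  reachable : ∀ (f : F) (s : Fin (ar f) → GTm F ar),
    E (.node f s) (.node f s) → ∀ i, E (s i) (s i)

/-- The join of two PCRs: the smallest PCR containing both. -/
def joinPCR {F : Type} {ar : F → ℕ} (E1 E2 : GTm F ar → GTm F ar → Prop)
    (a b : GTm F ar) : Prop :=
  ∀ E : GTm F ar → GTm F ar → Prop, IsPCR E →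
    (∀ x y, E1 x y → E x y) → (∀ x y, E2 x y → E x y) → E a b

/-! ## Term rewriting systems -/

/-- A term rewriting system: a finite set of rules `lhs → rhs` between patterns
(terms with variables drawn from `ℕ`), with `Var(rhs) ⊆ Var(lhs)`. -/
structure TRS (F : Type) (ar : F → ℕ) where
  rules : Set (Tm F ar ℕ × Tm F ar ℕ)
  finite : rules.Finite
  var_cond : ∀ r ∈ rules, Tm.vars r.2 ⊆ Tm.vars r.1

/-- The ground rewrite relation `→_R` determined by a TRS. -/
inductive RWStep {F : Type} {ar : F → ℕ} (R : TRS F ar) : GTm F ar → GTm F ar → Prop where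
  | rule {l r : Tm F ar ℕ} (h : (l, r) ∈ R.rules) (σ : ℕ → GTm F ar) :
      RWStep R (l.subst σ) (r.subst σ)
  | congr {f : F} {ts : Fin (ar f) → GTm F ar} {i : Fin (ar f)} {u : GTm F ar} :
      RWStep R (ts i) u → RWStep R (.node f ts) (.node f (Function.update ts i u))

/-- `≈_R` : the reflexive-symmetric-transitive closure of `→_R`. -/
def TRSEqv {F : Type} {ar : F → ℕ} (R : TRS F ar) : GTm F ar → GTm F ar → Prop :=
  Relation.ReflTransGen fun a b => RWStep R a b ∨ RWStep R b a

/-! ## E-matching, insertion and congruence closure -/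

/-- An e-match of a rule in an E-graph: a substitution `σ` into E-classes and a root
E-class `c` with `lhs[σ] →*_G c`. -/
structure EMatch {F : Type} {ar : F → ℕ} (R : TRS F ar) (G : EGraph F ar) : Type where
  lhs : Tm F ar ℕ
  rhs : Tm F ar ℕ
  mem : (lhs, rhs) ∈ R.rules
  sub : ℕ → G.Q
  root : G.Q
  acc : Accepts G.toAutomaton (Tm.map sub lhs) root

/-- Fresh states of the flattenings added by the match/apply operator: one state per
(match, subterm of the instantiated right-hand side). -/
def MExtra {F : Type} {ar : F → ℕ} (R : TRS F ar) (G : EGraph F ar) : Type :=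
  { p : EMatch R G × Tm F ar G.Q // Subterm p.2 (Tm.map p.1.sub p.1.rhs) }

open Classical in
/-- The state of the flattening `FL(rhs[σ] →* c)` associated to a subterm `u` of `rhs[σ]`:
states at the leaves are kept, the root is mapped to `c = root`, and all other subterms
get a fresh state. -/
noncomputable def stateOf {F : Type} {ar : F → ℕ} (R : TRS F ar) (G : EGraph F ar)
    (m : EMatch R G) :
    (u : Tm F ar G.Q) → Subterm u (Tm.map m.sub m.rhs) → G.Q ⊕ MExtra R G
  | .var q, _ => Sum.inl q
  | .node f ts, h =>
      if Tm.node f ts = Tm.map m.sub m.rhs then Sum.inl m.root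
      else Sum.inr ⟨(m, Tm.node f ts), h⟩

/-- The match/apply operator `T_R`: the (possibly non-deterministic) tree automaton
obtained from `G` by inserting the flattening `FL(rhs[σ] →* c)` for every e-match. -/
noncomputable def TRaut {F : Type} {ar : F → ℕ} (R : TRS F ar) (G : EGraph F ar) :
    Automaton F ar where
  Q := G.Q ⊕ MExtra R G
  trans f := { p |
    (∃ (qs : Fin (ar f) → G.Q) (q : G.Q), (qs, q) ∈ G.trans f ∧
      p = (fun i => Sum.inl (qs i), Sum.inl q)) ∨
    (∃ (m : EMatch R G) (ts : Fin (ar f) → Tm F ar G.Q)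
        (h : Subterm (.node f ts) (Tm.map m.sub m.rhs)),
      p = (fun i => stateOf R G m (ts i) (Subterm.child i h),
           stateOf R G m (.node f ts) h)) }

/-- `G` is the congruence closure (rebuilding) of the automaton `A`: the ⊑-least E-graph
above `A`. -/
def IsCC {F : Type} {ar : F → ℕ} (A : Automaton F ar) (G : EGraph F ar) : Prop :=
  ALe A G.toAutomaton ∧ ∀ H : EGraph F ar, ALe A H.toAutomaton → EGraph.Le G H

/-- `H` is (up to isomorphism) the result of the immediate consequence operator
`ICO_R = CC ∘ T_R` applied to `G`. -/
def IsICO {F : Type} {ar : F → ℕ} (R : TRS F ar) (G H : EGraph F ar) : Prop :=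
  IsCC (TRaut R G) H

/-- `S` is the sequence of iterates `S i = ICO_R^(i)(G)`. -/
def IterSeq {F : Type} {ar : F → ℕ} (R : TRS F ar) (G : EGraph F ar)
    (S : ℕ → EGraph F ar) : Prop :=
  S 0 = G ∧ ∀ i, IsICO R (S i) (S (i + 1))

/-- `H` is a least upper bound of the sequence `S` of E-graphs. -/
def IsLUBseq {F : Type} {ar : F → ℕ} (S : ℕ → EGraph F ar) (H : EGraph F ar) : Prop :=
  (∀ i, (S i).Le H) ∧ ∀ H' : EGraph F ar, (∀ i, (S i).Le H') → H.Le H'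

/-- `H` is a least upper bound of the family `Gs` of E-graphs. -/
def IsLUBfam {F : Type} {ar : F → ℕ} {I : Type} (Gs : I → EGraph F ar)
    (H : EGraph F ar) : Prop :=
  (∀ i, (Gs i).Le H) ∧ ∀ H' : EGraph F ar, (∀ i, (Gs i).Le H') → H.Le H'

/-- `H = EqSat(R, G) = ⊔_{i ≥ 0} ICO_R^(i)(G)`. -/
def IsEqSat {F : Type} {ar : F → ℕ} (R : TRS F ar) (G H : EGraph F ar) : Prop :=
  ∃ S : ℕ → EGraph F ar, IterSeq R G S ∧ IsLUBseq S H

/-- `H` is a model of the TRS `R`. -/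
def ModelTRS {F : Type} {ar : F → ℕ} (R : TRS F ar) (H : EGraph F ar) : Prop :=
  ∀ r ∈ R.rules, ∀ (σ : ℕ → H.Q) (c : H.Q),
    Accepts H.toAutomaton (Tm.map σ r.1) c → Accepts H.toAutomaton (Tm.map σ r.2) c

/-- `H` is a model of the pair `(R, G)`. -/
def IsModelOf {F : Type} {ar : F → ℕ} (R : TRS F ar) (G H : EGraph F ar) : Prop :=
  G.Le H ∧ ModelTRS R H

/-- `H` is a universal model of the pair `(R, G)`. -/
def IsUniversalModel {F : Type} {ar : F → ℕ} (R : TRS F ar) (G H : EGraph F ar) : Prop :=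
  IsModelOf R G H ∧ ∀ H' : EGraph F ar, IsModelOf R G H' → H.Le H'

/-- `G` is (up to isomorphism) the flattening `FL(t →* c)` of a ground term `t`:
the ⊑-least E-graph representing `t`. -/
def IsTermEG {F : Type} {ar : F → ℕ} (t : GTm F ar) (G : EGraph F ar) : Prop :=
  (∃ c, G.toAutomaton.AcceptsG t c) ∧
  ∀ H : EGraph F ar, (∃ c, H.toAutomaton.AcceptsG t c) → G.Le H

/-- Equality saturation terminates on `(R, G)`: the sequence of iterates
`ICO_R^(i)(G)` is eventually constant up to isomorphism. -/
def EqSatTerminates {F : Type} {ar : F → ℕ} (R : TRS F ar) (G : EGraph F ar) : Prop :=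
  ∃ S : ℕ → EGraph F ar, IterSeq R G S ∧ ∃ n, ∀ m, n ≤ m → (S m).Iso (S n)

section Acceptance

variable {F : Type} {ar : F → ℕ}

theorem Automaton.acceptsG_node {A : Automaton F ar} {f : F} {ts : Fin (ar f) → GTm F ar}
    {q : A.Q} :
    A.AcceptsG (.node f ts) q ↔
      ∃ qs : Fin (ar f) → A.Q, (∀ i, A.AcceptsG (ts i) (qs i)) ∧ (qs, q) ∈ A.trans f := by
  constructor
  · intro h
    cases h with
    | node hs ht => exact ⟨_, hs, ht⟩
  · rintro ⟨qs, hs, ht⟩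
    exact Accepts.node hs ht

theorem AHom.acceptsG {A B : Automaton F ar} (h : AHom A B) (t : GTm F ar) :
    ∀ {q : A.Q}, A.AcceptsG t q → B.AcceptsG t (h.toFun q) := by
  induction t with
  | var e => exact e.elim
  | node f ts ih =>
    intro q hq
    obtain ⟨qs, hs, ht⟩ := Automaton.acceptsG_node.1 hq
    exact Automaton.acceptsG_node.2 ⟨_, fun i => ih i (hs i), h.map_trans f qs q ht⟩

theorem ALe.trans {A B C : Automaton F ar} (hAB : ALe A B) (hBC : ALe B C) :
    ALe A C := by
  obtain ⟨g⟩ := hAB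
  obtain ⟨h⟩ := hBC
  exact ⟨⟨h.toFun ∘ g.toFun, fun f qs q hq => h.map_trans f _ _ (g.map_trans f qs q hq)⟩⟩

end Acceptance

namespace EGraph

variable {F : Type} {ar : F → ℕ}

theorem Le.trans {G H K : EGraph F ar} (hGH : G.Le H) (hHK : H.Le K) : G.Le K :=
  ALe.trans hGH hHK

theorem Le.eqv {G H : EGraph F ar} (hGH : G.Le H) {s t : GTm F ar} (h : G.eqv s t) :
    H.eqv s t := by
  obtain ⟨g⟩ := hGH
  obtain ⟨q, hs, ht⟩ := h
  exact ⟨g.toFun q, g.acceptsG s hs, g.acceptsG t ht⟩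

/-- `⊑` is antisymmetric up to isomorphism. -/
theorem Le.antisymm {G H : EGraph F ar} (hGH : G.Le H) (hHG : H.Le G) : G.Iso H := by
  obtain ⟨g⟩ := hGH
  obtain ⟨h⟩ := hHG
  refine ⟨g, h, fun q => ?_, fun q => ?_⟩
  · obtain ⟨t, ht⟩ := G.reach q
    exact G.det t _ _ (h.acceptsG t (g.acceptsG t ht)) ht
  · obtain ⟨t, ht⟩ := H.reach q
    exact H.det t _ _ (g.acceptsG t (h.acceptsG t ht)) ht

/-- A choice of representatives of the states of `G` whose transitions hold in `H`
induces a homomorphism. -/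
theorem le_of_rep {G H : EGraph F ar} (rep : G.Q → GTm F ar)
    (hrep : ∀ q, H.eqv (rep q) (rep q))
    (htrans : ∀ (f : F) (qs : Fin (ar f) → G.Q) (q : G.Q), (qs, q) ∈ G.trans f →
      H.eqv (.node f fun i => rep (qs i)) (rep q)) : G.Le H := by
  choose φ hφ _ using hrep
  refine ⟨⟨φ, fun f qs q hq => ?_⟩⟩
  obtain ⟨p, hp, hp'⟩ := htrans f qs q hq
  obtain ⟨ps, hps, ht⟩ := Automaton.acceptsG_node.1 hp
  have hqs : ps = fun i => φ (qs i) := funext fun i => H.det _ _ _ (hps i) (hφ (qs i))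
  rw [H.det _ _ _ (hφ q) hp', ← hqs]
  exact ht

theorem eqv_node_rep {G : EGraph F ar} {rep : G.Q → GTm F ar}
    (hrep : ∀ q, G.AcceptsG (rep q) q) {f : F} {qs : Fin (ar f) → G.Q} {q : G.Q}
    (h : (qs, q) ∈ G.trans f) : G.eqv (.node f fun i => rep (qs i)) (rep q) :=
  ⟨q, Automaton.acceptsG_node.2 ⟨qs, fun i => hrep (qs i), h⟩, hrep q⟩

theorem le_of_eqv {G H : EGraph F ar} (h : ∀ s t, G.eqv s t → H.eqv s t) : G.Le H := by
  choose rep hrep using G.reach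
  exact le_of_rep rep (fun q => h _ _ ⟨q, hrep q, hrep q⟩)
    fun f qs q hq => h _ _ (eqv_node_rep hrep hq)

theorem isPCR_eqv (G : EGraph F ar) : IsPCR G.eqv where
  symm := fun ⟨q, h1, h2⟩ => ⟨q, h2, h1⟩
  trans := by
    rintro t1 t2 t3 ⟨q, h1, h2⟩ ⟨p, h3, h4⟩
    exact ⟨q, h1, G.det _ _ _ h3 h2 ▸ h4⟩
  congruent := by
    rintro f s t hst ⟨q, hq, -⟩
    obtain ⟨qs, hs, htr⟩ := Automaton.acceptsG_node.1 hq
    refine ⟨q, hq, Automaton.acceptsG_node.2 ⟨qs, fun i => ?_, htr⟩⟩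
    obtain ⟨p, h1, h2⟩ := hst i
    exact G.det _ _ _ h1 (hs i) ▸ h2
  reachable := by
    rintro f s ⟨q, hq, -⟩ i
    obtain ⟨qs, hs, -⟩ := Automaton.acceptsG_node.1 hq
    exact ⟨qs i, hs i, hs i⟩

end EGraph

namespace IsPCR

variable {F : Type} {ar : F → ℕ} {E : GTm F ar → GTm F ar → Prop}

/-- The equivalence relation induced by a PCR on its domain. -/
def setoid (hE : IsPCR E) : Setoid {t : GTm F ar // E t t} where
  r s t := E s.1 t.1
  iseqv := ⟨fun s => s.2, hE.symm, hE.trans⟩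

/-- The tree automaton whose states are the classes of a PCR. -/
def automaton (hE : IsPCR E) : Automaton F ar where
  Q := Quotient hE.setoid
  trans f := {p | ∃ (s : Fin (ar f) → GTm F ar) (h : E (.node f s) (.node f s)),
    p = (fun i => Quotient.mk hE.setoid ⟨s i, hE.reachable f s h i⟩,
      Quotient.mk hE.setoid ⟨.node f s, h⟩)}

theorem acceptsG_mk (hE : IsPCR E) (t : GTm F ar) :
    ∀ h : E t t, hE.automaton.AcceptsG t (Quotient.mk hE.setoid ⟨t, h⟩) := by
  induction t with
  | var e => exact e.elim
  | node f ts ih =>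
    intro h
    exact Automaton.acceptsG_node.2 ⟨_, fun i => ih i (hE.reachable f ts h i), ts, h, rfl⟩

theorem eq_mk_of_acceptsG (hE : IsPCR E) (t : GTm F ar) :
    ∀ {q : hE.automaton.Q}, hE.automaton.AcceptsG t q →
      ∃ h : E t t, q = Quotient.mk hE.setoid ⟨t, h⟩ := by
  induction t with
  | var e => exact e.elim
  | node f ts ih =>
    intro q hq
    obtain ⟨qs, hs, s, h, hp⟩ := Automaton.acceptsG_node.1 hq
    obtain ⟨rfl, rfl⟩ := Prod.mk.inj hp
    have hst : E (.node f s) (.node f ts) := by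
      refine hE.congruent f s ts (fun i => ?_) h
      obtain ⟨hi, hqi⟩ := ih i (hs i)
      exact Quotient.exact hqi
    exact ⟨hE.trans (hE.symm hst) hst, Quotient.sound hst⟩

/-- The E-graph whose states are the classes of a PCR. -/
def eGraph (hE : IsPCR E) : EGraph F ar where
  toAutomaton := hE.automaton
  det := by
    intro t q1 q2 h1 h2
    obtain ⟨_, rfl⟩ := hE.eq_mk_of_acceptsG t h1
    obtain ⟨_, rfl⟩ := hE.eq_mk_of_acceptsG t h2
    rfl
  reach := by
    intro q
    obtain ⟨⟨t, h⟩, rfl⟩ := Quotient.exists_rep q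
    exact ⟨t, hE.acceptsG_mk t h⟩

theorem eGraph_eqv (hE : IsPCR E) {s t : GTm F ar} : hE.eGraph.eqv s t ↔ E s t := by
  constructor
  · rintro ⟨q, hs, ht⟩
    obtain ⟨_, rfl⟩ := hE.eq_mk_of_acceptsG s hs
    obtain ⟨_, h⟩ := hE.eq_mk_of_acceptsG t ht
    exact Quotient.exact h
  · intro h
    have hs : E s s := hE.trans h (hE.symm h)
    have ht : E t t := hE.trans (hE.symm h) h
    have heq : Quotient.mk hE.setoid ⟨s, hs⟩ = Quotient.mk hE.setoid ⟨t, ht⟩ :=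
      Quotient.sound h
    exact ⟨_, hE.acceptsG_mk s hs, heq ▸ hE.acceptsG_mk t ht⟩

end IsPCR

/-- A property that is monotone in `n` and eventually holds at each point of a finite type
eventually holds uniformly. -/
theorem exists_forall_of_monotone {α : Type*} [Finite α] {P : ℕ → α → Prop}
    (hmono : ∀ {m n : ℕ}, m ≤ n → ∀ a, P m a → P n a) (h : ∀ a, ∃ n, P n a) :
    ∃ n, ∀ a, P n a := by
  choose k hk using h
  obtain ⟨n, hn⟩ := Finite.exists_le k
  exact ⟨n, fun a => hmono (hn a) a (hk a)⟩

/-- The union of an ascending sequence of PCRs is a PCR. -/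
theorem isPCR_iUnion {F : Type} {ar : F → ℕ} {E : ℕ → GTm F ar → GTm F ar → Prop}
    (hE : ∀ n, IsPCR (E n)) (hmono : ∀ {m n : ℕ}, m ≤ n → ∀ s t, E m s t → E n s t) :
    IsPCR fun s t => ∃ n, E n s t where
  symm := fun ⟨n, h⟩ => ⟨n, (hE n).symm h⟩
  trans := fun ⟨m, h⟩ ⟨n, h'⟩ => ⟨max m n,
    (hE _).trans (hmono (le_max_left m n) _ _ h) (hmono (le_max_right m n) _ _ h')⟩
  congruent := by
    rintro f s t hst ⟨m, h⟩
    obtain ⟨n, hn⟩ := exists_forall_of_monotone (P := fun n i => E n (s i) (t i))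
      (fun hmn i => hmono hmn _ _) hst
    exact ⟨max m n, (hE _).congruent f s t
      (fun i => hmono (le_max_right m n) _ _ (hn i)) (hmono (le_max_left m n) _ _ h)⟩
  reachable := fun f s ⟨n, h⟩ i => ⟨n, (hE n).reachable f s h i⟩

/-- The congruence of the least upper bound of an ascending sequence is contained in the
union of the congruences. -/
theorem IsLUBseq.exists_eqv {F : Type} {ar : F → ℕ} {S : ℕ → EGraph F ar} {H : EGraph F ar}
    (hH : IsLUBseq S H)
    (hmono : ∀ {m n : ℕ}, m ≤ n → ∀ s t, (S m).eqv s t → (S n).eqv s t)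
    {s t : GTm F ar} (h : H.eqv s t) : ∃ n, (S n).eqv s t := by
  have hE := isPCR_iUnion (fun n => (S n).isPCR_eqv) hmono
  have hle : H.Le hE.eGraph :=
    hH.2 _ fun n => EGraph.le_of_eqv fun s t hst => hE.eGraph_eqv.2 ⟨n, hst⟩
  exact hE.eGraph_eqv.1 (hle.eqv h)

/-- Finite convergence: there is no infinite strictly ascending sequence
`G₁ ⊏ G₂ ⊏ ⋯` of finite E-graphs whose least upper bound is finite.  (Equivalently,
if the least upper bound of a strictly ascending sequence of finite E-graphs is a
finite E-graph, then the sequence is finite.) -/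
theorem finite_convergence {F : Type} {ar : F → ℕ} [Finite F]
    (S : ℕ → EGraph F ar) (hfin : ∀ i, (S i).IsFinite)
    (hasc : ∀ i, (S i).Le (S (i + 1)) ∧ ¬ (S i).Iso (S (i + 1)))
    (H : EGraph F ar) (hH : IsLUBseq S H) :
    ¬ H.IsFinite := by
  rintro ⟨hQ, hT⟩
  have hmono : ∀ {m n : ℕ}, m ≤ n → ∀ s t, (S m).eqv s t → (S n).eqv s t := by
    intro m n hmn s t h
    induction n, hmn using Nat.le_induction with
    | base => exact h
    | succ n _ ih => exact (hasc n).1.eqv ih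
  choose rep hrep using H.reach
  obtain ⟨m, hm⟩ := exists_forall_of_monotone (P := fun n q => (S n).eqv (rep q) (rep q))
    (fun hmn q => hmono hmn _ _)
    fun q => hH.exists_eqv hmono ⟨q, hrep q, hrep q⟩
  have (f : F) : Finite (H.trans f) := hT f
  obtain ⟨n, hn⟩ := exists_forall_of_monotone
    (P := fun n (p : Σ f, H.trans f) =>
      (S n).eqv (.node p.1 fun i => rep (p.2.1.1 i)) (rep p.2.1.2))
    (fun hmn q => hmono hmn _ _)
    fun p => hH.exists_eqv hmono (EGraph.eqv_node_rep hrep p.2.2)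
  have hle : H.Le (S (max m n)) := EGraph.le_of_rep rep
    (fun q => hmono (le_max_left m n) _ _ (hm q))
    fun f qs q hq => hmono (le_max_right m n) _ _ (hn ⟨f, (qs, q), hq⟩)
  exact (hasc _).2 ((hasc _).1.antisymm ((hH.1 _).trans hle))
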